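/- arXiv:0709.0326 — 3 statements merged into one kernel-verified Lean document; each statement's English description precedes it below -/
import Mathlib

section
/- In ℤS₄, for every integer i ≥ 1 the coefficients of m_{i,i} := L₂^iL₃^i + L₂^iL₄^i + L₃^iL₄^i satisfy: 12·⟨1,m_{i,i}⟩ = 6^i + 3^i + 10·2^i + 9·(−2)^i + 11·(−1)^i; ⟨s₁,m_{i,i}⟩ = 0; 12·⟨s₁₂,m_{i,i}⟩ = 6^i + 3^i + 2^i − (−1)^i; 12·⟨s₁₃,m_{i,i}⟩ = 6^i + 3^i − 2·2^i − (−1)^i − 3·(−2)^i; ⟨s₁₂₃,m_{i,i}⟩ = 0. -/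
open MonoidAlgebra hiding coeff

noncomputable def L2 : MonoidAlgebra ℤ (Equiv.Perm (Fin 4)) := single (Equiv.swap 0 1) 1
noncomputable def L3 : MonoidAlgebra ℤ (Equiv.Perm (Fin 4)) :=
  single (Equiv.swap 0 2) 1 + single (Equiv.swap 1 2) 1
noncomputable def L4 : MonoidAlgebra ℤ (Equiv.Perm (Fin 4)) :=
  single (Equiv.swap 0 3) 1 + single (Equiv.swap 1 3) 1 + single (Equiv.swap 2 3) 1

/-- The coefficient of the group element `w` in `h ∈ ℤS₄`. -/
def coeff (h : MonoidAlgebra ℤ (Equiv.Perm (Fin 4))) (w : Equiv.Perm (Fin 4)) : ℤ :=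
  (h.coeff : (Equiv.Perm (Fin 4)) →₀ ℤ) w

/-- `s₁ = (1 2)` -/
def s1 : Equiv.Perm (Fin 4) := Equiv.swap 0 1
/-- `s₁₂ = (1 2 3)`, a 3-cycle -/
def s12 : Equiv.Perm (Fin 4) := Equiv.swap 0 1 * Equiv.swap 1 2
/-- `s₁₃ = (1 2)(3 4)` -/
def s13 : Equiv.Perm (Fin 4) := Equiv.swap 0 1 * Equiv.swap 2 3
/-- `s₁₂₃ = (1 2 3 4)`, a 4-cycle -/
def s123 : Equiv.Perm (Fin 4) := Equiv.swap 0 1 * Equiv.swap 1 2 * Equiv.swap 2 3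

/-- `m_{i,i} = m_{(i,i)}(L₁,L₂,L₃,L₄)` (recall `L₁ = 0`). -/
noncomputable def mII (i : ℕ) : MonoidAlgebra ℤ (Equiv.Perm (Fin 4)) :=
  L2 ^ i * L3 ^ i + L2 ^ i * L4 ^ i + L3 ^ i * L4 ^ i


def jmTab : List (List ℤ) := [
  [0, 0, 0, 0, 0, 0, 2, 2, 0, 2, 0, 2, 0, 2, 2, 0, 0, 0, 2, 2, 0, 0, 0, 0, 2, 0, 0, 2, 2, 0, 2, 0, 0, 2, 0, 2, 2, 0, 0, 2, 0, 0, 0, 0, 2, 2, 0, 0, 0, 2, 2, 0, 2, 0, 2, 0, 2, 2, 0, 0, 0, 0, 0, 0],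
  [0, 0, 0, 0, 0, 0, 6, -2, 0, 6, 0, -2, 0, -2, -2, 0, 0, 0, 6, -2, 0, 0, 0, 0, 6, 0, 0, -2, -2, 0, -2, 0, 0, 6, 0, -2, 6, 0, 0, -2, 0, 0, 0, 0, -2, -2, 0, 0, 0, -2, -2, 0, -2, 0, -2, 0, -2, -2, 0, 0, 0, 0, 0, 0],
  [0, 0, 0, 0, 0, 0, 6, 2, 0, -3, 0, -1, 0, -1, 5, 0, 0, 0, 6, 2, 0, 0, 0, 0, -3, 0, 0, -1, -1, 0, 5, 0, 0, -3, 0, -1, -3, 0, 0, -1, 0, 0, 0, 0, -4, -4, 0, 0, 0, -1, 5, 0, -1, 0, 5, 0, -4, -4, 0, 0, 0, 0, 0, 0],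
  [0, 0, 0, 0, 0, 0, 4, 4, 0, -2, 0, -2, 0, -2, -2, 0, 0, 0, 4, 4, 0, 0, 0, 0, -2, 0, 0, -2, -2, 0, -2, 0, 0, -2, 0, -2, -2, 0, 0, -2, 0, 0, 0, 0, 4, 4, 0, 0, 0, -2, -2, 0, -2, 0, -2, 0, 4, 4, 0, 0, 0, 0, 0, 0],
  [0, 0, 0, 0, 0, 0, 6, -6, 0, -3, 0, 3, 0, 3, -3, 0, 0, 0, 6, -6, 0, 0, 0, 0, -3, 0, 0, 3, 3, 0, -3, 0, 0, -3, 0, 3, -3, 0, 0, 3, 0, 0, 0, 0, 0, 0, 0, 0, 0, 3, -3, 0, 3, 0, -3, 0, 0, 0, 0, 0, 0, 0, 0, 0],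
  [0, 0, 0, 0, 0, 0, 2, -2, 0, -2, 0, 2, 0, 2, -2, 0, 0, 0, -2, 2, 0, 0, 0, 0, 2, 0, 0, -2, -2, 0, 2, 0, 0, 2, 0, -2, -2, 0, 0, 2, 0, 0, 0, 0, 2, -2, 0, 0, 0, -2, 2, 0, 2, 0, -2, 0, -2, 2, 0, 0, 0, 0, 0, 0],
  [0, 0, 0, 0, 0, 0, 6, 2, 0, -6, 0, -2, 0, -2, 2, 0, 0, 0, -6, -2, 0, 0, 0, 0, 6, 0, 0, 2, 2, 0, -2, 0, 0, 6, 0, 2, -6, 0, 0, -2, 0, 0, 0, 0, -2, 2, 0, 0, 0, 2, -2, 0, -2, 0, 2, 0, 2, -2, 0, 0, 0, 0, 0, 0],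
  [0, 0, 0, 0, 0, 0, 6, -2, 0, 3, 0, -1, 0, -1, -5, 0, 0, 0, -6, 2, 0, 0, 0, 0, -3, 0, 0, 1, 1, 0, 5, 0, 0, -3, 0, 1, 3, 0, 0, -1, 0, 0, 0, 0, -4, 4, 0, 0, 0, 1, 5, 0, -1, 0, -5, 0, 4, -4, 0, 0, 0, 0, 0, 0],
  [0, 0, 0, 0, 0, 0, 4, -4, 0, 2, 0, -2, 0, -2, 2, 0, 0, 0, -4, 4, 0, 0, 0, 0, -2, 0, 0, 2, 2, 0, -2, 0, 0, -2, 0, 2, 2, 0, 0, -2, 0, 0, 0, 0, 4, -4, 0, 0, 0, 2, -2, 0, -2, 0, 2, 0, -4, 4, 0, 0, 0, 0, 0, 0],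
  [0, 0, 0, 0, 0, 0, 6, 6, 0, 3, 0, 3, 0, 3, 3, 0, 0, 0, -6, -6, 0, 0, 0, 0, -3, 0, 0, -3, -3, 0, -3, 0, 0, -3, 0, -3, 3, 0, 0, 3, 0, 0, 0, 0, 0, 0, 0, 0, 0, -3, -3, 0, 3, 0, 3, 0, 0, 0, 0, 0, 0, 0, 0, 0]]

/-- The (scaled) joint eigenvectors of the Jucys-Murphy elements. -/
def jmE (t : Fin 10) (w : Equiv.Perm (Fin 4)) : ℤ :=
  (jmTab.getD t.val []).getD (16 * (w 0).val + 4 * (w 1).val + (w 2).val) 0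

def jc2 : Fin 10 → ℤ := ![1, 1, 1, 1, 1, -1, -1, -1, -1, -1]
def jc3 : Fin 10 → ℤ := ![2, 2, -1, -1, -1, -2, -2, 1, 1, 1]
def jc4 : Fin 10 → ℤ := ![3, -1, 2, 0, -2, -3, 1, -2, 0, 2]

theorem jm_init : ∀ w : Equiv.Perm (Fin 4), ∑ t, jmE t w = if w = 1 then 48 else 0 := by
  decide +kernel

theorem jm_e2 : ∀ w : Equiv.Perm (Fin 4), ∀ t, jmE t (Equiv.swap 0 1 * w) = jc2 t * jmE t w := by
  decide +kernel

theorem jm_e3 : ∀ w : Equiv.Perm (Fin 4), ∀ t, jmE t (Equiv.swap 0 2 * w)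
    + jmE t (Equiv.swap 1 2 * w) = jc3 t * jmE t w := by
  decide +kernel

theorem jm_e4 : ∀ w : Equiv.Perm (Fin 4), ∀ t, jmE t (Equiv.swap 0 3 * w)
    + jmE t (Equiv.swap 1 3 * w) + jmE t (Equiv.swap 2 3 * w) = jc4 t * jmE t w := by
  decide +kernel

theorem coeff_add' (g h : MonoidAlgebra ℤ (Equiv.Perm (Fin 4))) (w) :
    coeff (g + h) w = coeff g w + coeff h w := by
  simp [coeff]

theorem coeff_single_mul' (g : Equiv.Perm (Fin 4)) (h : MonoidAlgebra ℤ (Equiv.Perm (Fin 4))) (w) :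
    coeff (single g 1 * h) w = coeff h (g⁻¹ * w) := by
  simp [coeff]

theorem jm_pow (a b c : ℕ) : ∀ w, 48 * coeff (L2 ^ a * (L3 ^ b * L4 ^ c)) w
    = ∑ t, jc2 t ^ a * jc3 t ^ b * jc4 t ^ c * jmE t w := by
  induction a with
  | succ a ih =>
    intro w
    rw [pow_succ', mul_assoc, L2, coeff_single_mul', Equiv.swap_inv, ← L2, ih]
    refine Finset.sum_congr rfl fun t _ => ?_
    rw [jm_e2]; ring
  | zero =>
  simp only [pow_zero, one_mul]
  induction b with
  | succ b ih =>
    intro w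
    rw [pow_succ', mul_assoc, L3, add_mul, coeff_add', coeff_single_mul', coeff_single_mul',
      Equiv.swap_inv, Equiv.swap_inv, ← L3, mul_add, ih, ih, ← Finset.sum_add_distrib]
    refine Finset.sum_congr rfl fun t _ => ?_
    linear_combination (jc3 t ^ b * jc4 t ^ c) * jm_e3 w t
  | zero =>
  simp only [pow_zero, one_mul]
  induction c with
  | succ c ih =>
    intro w
    rw [pow_succ', L4, add_mul, add_mul, coeff_add', coeff_add', coeff_single_mul',
      coeff_single_mul', coeff_single_mul',
      Equiv.swap_inv, Equiv.swap_inv, Equiv.swap_inv, ← L4, mul_add, mul_add, ih, ih, ih,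
      ← Finset.sum_add_distrib, ← Finset.sum_add_distrib]
    refine Finset.sum_congr rfl fun t _ => ?_
    linear_combination (jc4 t ^ c) * jm_e4 w t
  | zero =>
    intro w
    simp only [pow_zero, one_mul, jm_init]
    by_cases h : w = 1
    · subst h; simp [coeff, MonoidAlgebra.one_def]
    · simp [coeff, MonoidAlgebra.one_def, h, Finsupp.single_apply, Ne.symm h]

theorem jm_mII (i : ℕ) (w) : 48 * coeff (mII i) w
    = ∑ t, ((jc2 t * jc3 t) ^ i + (jc2 t * jc4 t) ^ i + (jc3 t * jc4 t) ^ i) * jmE t w := by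
  have h1 := jm_pow i i 0 w
  have h2 := jm_pow i 0 i w
  have h3 := jm_pow 0 i i w
  simp only [pow_zero, one_mul, mul_one] at h1 h2 h3
  rw [mII, coeff_add', coeff_add', mul_add, mul_add, h1, h2, h3, ← Finset.sum_add_distrib,
    ← Finset.sum_add_distrib]
  refine Finset.sum_congr rfl fun t _ => ?_
  rw [mul_pow, mul_pow, mul_pow]; ring

theorem jmE_one : (fun t => jmE t 1) = ![2, 6, 6, 4, 6, 2, 6, 6, 4, 6] := by
  decide +kernel

theorem jmE_s1 : (fun t => jmE t s1) = ![2, 6, 6, 4, 6, -2, -6, -6, -4, -6] := by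
  decide +kernel

theorem jmE_s12 : (fun t => jmE t s12) = ![2, 6, -3, -2, -3, 2, 6, -3, -2, -3] := by
  decide +kernel

theorem jmE_s13 : (fun t => jmE t s13) = ![2, -2, 2, 4, -6, 2, -2, 2, 4, -6] := by
  decide +kernel

theorem jmE_s123 : (fun t => jmE t s123) = ![2, -2, -1, -2, 3, -2, 2, 1, 2, -3] := by
  decide +kernel

theorem closed_forms_mII (i : ℕ) (hi : 1 ≤ i) :
    12 * coeff (mII i) 1
        = 6 ^ i + 3 ^ i + 10 * 2 ^ i + 9 * (-2 : ℤ) ^ i + 11 * (-1 : ℤ) ^ i ∧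
    coeff (mII i) s1 = 0 ∧
    12 * coeff (mII i) s12 = 6 ^ i + 3 ^ i + 2 ^ i - (-1 : ℤ) ^ i ∧
    12 * coeff (mII i) s13
        = 6 ^ i + 3 ^ i - 2 * 2 ^ i - (-1 : ℤ) ^ i - 3 * (-2 : ℤ) ^ i ∧
    coeff (mII i) s123 = 0 := by
  have h0 : (0 : ℤ) ^ i = 0 := zero_pow (by omega)
  have k1 := jm_mII i 1
  have k2 := jm_mII i s1
  have k3 := jm_mII i s12
  have k4 := jm_mII i s13
  have k5 := jm_mII i s123
  simp only [fun t => congrFun jmE_one t] at k1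
  simp only [fun t => congrFun jmE_s1 t] at k2
  simp only [fun t => congrFun jmE_s12 t] at k3
  simp only [fun t => congrFun jmE_s13 t] at k4
  simp only [fun t => congrFun jmE_s123 t] at k5
  simp [Fin.sum_univ_succ, jc2, jc3, jc4, h0] at k1 k2 k3 k4 k5
  refine ⟨?_, ?_, ?_, ?_, ?_⟩ <;> linarith
end

section
/- In ℤS₄, for every integer i ≥ 1 the coefficients of m_{i,i,i} := L₂^iL₃^iL₄^i satisfy: 4·⟨1,m_{i,i,i}⟩ = (1+(−1)^i)(6^{i-1} + 3·2^{i-1}); 4·⟨s₁,m_{i,i,i}⟩ = (1−(−1)^i)(6^{i-1} − 2^{i-1}); 4·⟨s₁₂,m_{i,i,i}⟩ = (1+(−1)^i)·6^{i-1}; 4·⟨s₁₃,m_{i,i,i}⟩ = (1+(−1)^i)(6^{i-1} − 2^{i-1}); 4·⟨s₁₂₃,m_{i,i,i}⟩ = (1−(−1)^i)(6^{i-1} + 2^{i-1}). -/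
open MonoidAlgebra hiding coeff

/-- `m_{i,i,i} = m_{(i,i,i)}(L₁,L₂,L₃,L₄)` (recall `L₁ = 0`). -/
noncomputable def mIII (i : ℕ) : MonoidAlgebra ℤ (Equiv.Perm (Fin 4)) := L2 ^ i * L3 ^ i * L4 ^ i

/-- The character `sign * (fix - 1)`. -/
def chB (g : Equiv.Perm (Fin 4)) : ℤ :=
  (Equiv.Perm.sign g : ℤ) * ((∑ j : Fin 4, if g j = j then (1 : ℤ) else 0) - 1)

/-- The six 4-cycles. -/
def cyc : List (Equiv.Perm (Fin 4)) :=
  [Equiv.swap 0 1 * Equiv.swap 0 2 * Equiv.swap 0 3,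
   Equiv.swap 0 1 * Equiv.swap 0 2 * Equiv.swap 1 3,
   Equiv.swap 0 1 * Equiv.swap 0 2 * Equiv.swap 2 3,
   Equiv.swap 0 1 * Equiv.swap 1 2 * Equiv.swap 0 3,
   Equiv.swap 0 1 * Equiv.swap 1 2 * Equiv.swap 1 3,
   Equiv.swap 0 1 * Equiv.swap 1 2 * Equiv.swap 2 3]

lemma comm23 : Commute L2 L3 := by
  unfold Commute SemiconjBy L2 L3
  simp only [mul_add, add_mul, single_mul_single, mul_one]
  rw [show (Equiv.swap 0 2 * Equiv.swap 0 1 : Equiv.Perm (Fin 4)) = Equiv.swap 0 1 * Equiv.swap 1 2 by decide,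
    show (Equiv.swap 1 2 * Equiv.swap 0 1 : Equiv.Perm (Fin 4)) = Equiv.swap 0 1 * Equiv.swap 0 2 by decide]
  abel

lemma comm24 : Commute L2 L4 := by
  unfold Commute SemiconjBy L2 L4
  simp only [mul_add, add_mul, single_mul_single, mul_one]
  rw [show (Equiv.swap 0 3 * Equiv.swap 0 1 : Equiv.Perm (Fin 4)) = Equiv.swap 0 1 * Equiv.swap 1 3 by decide,
    show (Equiv.swap 1 3 * Equiv.swap 0 1 : Equiv.Perm (Fin 4)) = Equiv.swap 0 1 * Equiv.swap 0 3 by decide,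
    show (Equiv.swap 2 3 * Equiv.swap 0 1 : Equiv.Perm (Fin 4)) = Equiv.swap 0 1 * Equiv.swap 2 3 by decide]
  abel

lemma comm34 : Commute L3 L4 := by
  unfold Commute SemiconjBy L3 L4
  simp only [mul_add, add_mul, single_mul_single, mul_one]
  rw [show (Equiv.swap 0 3 * Equiv.swap 0 2 : Equiv.Perm (Fin 4)) = Equiv.swap 0 2 * Equiv.swap 2 3 by decide,
    show (Equiv.swap 1 3 * Equiv.swap 0 2 : Equiv.Perm (Fin 4)) = Equiv.swap 0 2 * Equiv.swap 1 3 by decide,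
    show (Equiv.swap 2 3 * Equiv.swap 0 2 : Equiv.Perm (Fin 4)) = Equiv.swap 0 2 * Equiv.swap 0 3 by decide,
    show (Equiv.swap 0 3 * Equiv.swap 1 2 : Equiv.Perm (Fin 4)) = Equiv.swap 1 2 * Equiv.swap 0 3 by decide,
    show (Equiv.swap 1 3 * Equiv.swap 1 2 : Equiv.Perm (Fin 4)) = Equiv.swap 1 2 * Equiv.swap 2 3 by decide,
    show (Equiv.swap 2 3 * Equiv.swap 1 2 : Equiv.Perm (Fin 4)) = Equiv.swap 1 2 * Equiv.swap 1 3 by decide]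
  abel

lemma mIII_eq (i : ℕ) : mIII i = (L2 * L3 * L4) ^ i := by
  unfold mIII
  rw [(Commute.mul_left comm24 comm34).mul_pow, comm23.mul_pow]

lemma coeff_step (h : MonoidAlgebra ℤ (Equiv.Perm (Fin 4))) (g : Equiv.Perm (Fin 4)) :
    coeff (L2 * L3 * L4 * h) g = (cyc.map fun c => coeff h (c⁻¹ * g)).sum := by
  unfold L2 L3 L4 cyc coeff
  simp only [mul_add, add_mul, single_mul_single, mul_one, List.map_cons, List.map_nil,
    List.sum_cons, List.sum_nil, MonoidAlgebra.coeff_add, Finsupp.add_apply, MonoidAlgebra.coeff_single_mul_apply, one_mul]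
  ring

lemma sgn_cyc : ∀ c ∈ cyc, Equiv.Perm.sign c = -1 := by decide

lemma chB_step : ∀ g, (cyc.map fun c => chB (c⁻¹ * g)).sum = 2 * chB g := by decide +kernel

lemma base0 : ∀ g : Equiv.Perm (Fin 4),
    4 * (cyc.map fun c => if c⁻¹ * g = 1 then (1 : ℤ) else 0).sum
      = (1 + chB g) * (1 - (Equiv.Perm.sign g : ℤ)) := by decide +kernel

lemma main_form (n : ℕ) : ∀ g : Equiv.Perm (Fin 4), 4 * coeff ((L2 * L3 * L4) ^ (n + 1)) g =
    (6 ^ n + chB g * 2 ^ n) * (1 - (Equiv.Perm.sign g : ℤ) * (-1) ^ n) := by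
  induction n with
  | zero =>
    intro g
    have h1 : ∀ w : Equiv.Perm (Fin 4), coeff 1 w = if w = 1 then 1 else 0 := by
      intro w
      simp only [coeff, MonoidAlgebra.one_def, MonoidAlgebra.coeff_single, Finsupp.single_apply, eq_comm]
    have := base0 g
    rw [pow_succ', coeff_step]
    simpa [h1] using this
  | succ n ih =>
    intro g
    have hs := chB_step g
    rw [pow_succ', coeff_step, ← List.sum_map_mul_left]
    have : ∀ c ∈ cyc, 4 * coeff ((L2 * L3 * L4) ^ (n + 1)) (c⁻¹ * g) =
        (6 ^ n + chB (c⁻¹ * g) * 2 ^ n) * (1 + (Equiv.Perm.sign g : ℤ) * (-1) ^ n) := by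
      intro c hc
      rw [ih, Equiv.Perm.sign_mul, Equiv.Perm.sign_inv, sgn_cyc c hc]
      push_cast
      ring
    rw [List.map_congr_left this]
    simp only [cyc, List.map_cons, List.map_nil, List.sum_cons, List.sum_nil] at hs ⊢
    linear_combination (2 ^ n * (1 + (Equiv.Perm.sign g : ℤ) * (-1) ^ n)) * hs


theorem closed_forms_mIII (i : ℕ) (hi : 1 ≤ i) :
    4 * coeff (mIII i) 1
        = (1 + (-1 : ℤ) ^ i) * (6 ^ (i - 1) + 3 * 2 ^ (i - 1)) ∧
    4 * coeff (mIII i) s1 = (1 - (-1 : ℤ) ^ i) * (6 ^ (i - 1) - 2 ^ (i - 1)) ∧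
    4 * coeff (mIII i) s12 = (1 + (-1 : ℤ) ^ i) * 6 ^ (i - 1) ∧
    4 * coeff (mIII i) s13 = (1 + (-1 : ℤ) ^ i) * (6 ^ (i - 1) - 2 ^ (i - 1)) ∧
    4 * coeff (mIII i) s123 = (1 - (-1 : ℤ) ^ i) * (6 ^ (i - 1) + 2 ^ (i - 1)) := by
  obtain ⟨n, rfl⟩ : ∃ n, i = n + 1 := ⟨i - 1, by omega⟩
  simp only [mIII_eq, main_form, Nat.add_sub_cancel]
  rw [show chB 1 = 3 by decide +kernel, show chB s1 = -1 by decide +kernel,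
    show chB s12 = 0 by decide +kernel, show chB s13 = -1 by decide +kernel,
    show chB s123 = 1 by decide +kernel, show Equiv.Perm.sign s1 = -1 by decide +kernel,
    show Equiv.Perm.sign s12 = 1 by decide +kernel, show Equiv.Perm.sign s13 = 1 by decide +kernel,
    show Equiv.Perm.sign s123 = -1 by decide +kernel, Equiv.Perm.sign_one]
  push_cast
  refine ⟨?_, ?_, ?_, ?_, ?_⟩ <;> ring
end

section
/- In ℤS₄, the five elements m_∅ := 1, m₁ := L₂ + L₃ + L₄, m₂ := L₂² + L₃² + L₄², m_{1,1} := L₂L₃ + L₂L₄ + L₃L₄, m_{1,1,1} := L₂L₃L₄ form a ℤ-module basis of the centre of ℤS₄: each of them lies in the centre, they are linearly independent over ℤ, and every element of the centre is a ℤ-linear combination of them. -/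
open MonoidAlgebra

abbrev P4 := Equiv.Perm (Fin 4)

def cls4 (g : P4) : Fin 5 :=
  if g = 1 then 0 else if g * g * g = 1 then 2 else
  if g * g = 1 then (if g 0 ≠ 0 ∧ g 1 ≠ 1 ∧ g 2 ≠ 2 then
    (if g 3 = 3 then 1 else 3) else 1) else 4

def rep4 : Fin 5 → P4 :=
  ![1, Equiv.swap 0 1, Equiv.swap 0 1 * Equiv.swap 1 2, Equiv.swap 0 1 * Equiv.swap 2 3,
    Equiv.swap 0 1 * Equiv.swap 1 2 * Equiv.swap 2 3]

def mat4 : Fin 5 → Fin 5 → ℤ :=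
  ![![1,0,0,0,0], ![0,1,0,0,0], ![6,0,1,0,0], ![0,0,1,1,0], ![0,0,0,0,1]]

noncomputable def vec4 : Fin 5 → MonoidAlgebra ℤ P4 :=
  ![1, L2 + L3 + L4, L2 ^ 2 + L3 ^ 2 + L4 ^ 2,
        L2 * L3 + L2 * L4 + L3 * L4, L2 * L3 * L4]

set_option maxRecDepth 100000 in
lemma cls4_rep : ∀ i, cls4 (rep4 i) = i := by decide +kernel

set_option maxRecDepth 100000 in
lemma cls4_comm : ∀ g h : P4, cls4 (h * g) = cls4 (g * h) := by decide +kernel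

set_option maxRecDepth 100000 in
lemma exists_conj4 : ∀ h : P4, ∃ g : P4, g * h * g⁻¹ = rep4 (cls4 h) := by decide +kernel

lemma coeff_vec4 (n : Fin 5) (g : P4) : (vec4 n).coeff g = mat4 n (cls4 g) := by
  revert g
  fin_cases n <;>
  simp only [vec4, L2, L3, L4, one_def, Fin.zero_eta, Fin.mk_one, Fin.reduceFinMk,
    Matrix.cons_val, pow_two, mul_add, add_mul, single_mul_single,
    coeff_add, Finsupp.add_apply, coeff_single, Finsupp.single_apply, mul_one] <;>
  decide +kernel

lemma central4 (z : MonoidAlgebra ℤ P4)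
    (h : ∀ g k : P4, z.coeff (k * g) = z.coeff (g * k)) :
    z ∈ Subalgebra.center ℤ (MonoidAlgebra ℤ P4) := by
  rw [Subalgebra.mem_center_iff]
  intro b
  induction b using MonoidAlgebra.induction_on with
  | of m =>
    ext k
    simp [of_apply, h]
  | add x y hx hy => rw [add_mul, mul_add, hx, hy]
  | smul r x hx => rw [smul_mul_assoc, hx, mul_smul_comm]

lemma coeff_central4 (z : MonoidAlgebra ℤ P4)
    (hz : z ∈ Subalgebra.center ℤ (MonoidAlgebra ℤ P4)) (h : P4) :
    z.coeff h = z.coeff (rep4 (cls4 h)) := by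
  rw [Subalgebra.mem_center_iff] at hz
  obtain ⟨g, hg⟩ := exists_conj4 h
  have := congrArg (fun w => w.coeff (g * h)) (hz (single g 1))
  rw [← hg]
  simpa using this

theorem monomial_basis_S4_one :
    let v : Fin 5 → MonoidAlgebra ℤ (Equiv.Perm (Fin 4)) :=
      ![1, L2 + L3 + L4, L2 ^ 2 + L3 ^ 2 + L4 ^ 2,
        L2 * L3 + L2 * L4 + L3 * L4, L2 * L3 * L4]
    (∀ n, v n ∈ Subalgebra.center ℤ (MonoidAlgebra ℤ (Equiv.Perm (Fin 4)))) ∧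
    LinearIndependent ℤ v ∧
    ∀ z ∈ Subalgebra.center ℤ (MonoidAlgebra ℤ (Equiv.Perm (Fin 4))),
      ∃ c : Fin 5 → ℤ, z = ∑ n, c n • v n := by
  intro v
  change (∀ n, vec4 n ∈ Subalgebra.center ℤ (MonoidAlgebra ℤ P4)) ∧
    LinearIndependent ℤ vec4 ∧
    ∀ z ∈ Subalgebra.center ℤ (MonoidAlgebra ℤ P4), ∃ c : Fin 5 → ℤ, z = ∑ n, c n • vec4 n
  have key : ∀ (c : Fin 5 → ℤ) (g : P4),
      (∑ n, c n • vec4 n).coeff g = ∑ n, c n * mat4 n (cls4 g) := by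
    intro c g
    simp only [coeff_sum, Finsupp.finsetSum_apply, coeff_smul_apply, coeff_vec4, smul_eq_mul]
  refine ⟨fun n => central4 _ fun g k => ?_, ?_, fun z hz => ?_⟩
  · rw [coeff_vec4, coeff_vec4, cls4_comm]
  · rw [Fintype.linearIndependent_iff]
    intro c hc
    have h : ∀ i, ∑ n, c n * mat4 n i = 0 := by
      intro i
      have := key c (rep4 i)
      rw [hc, cls4_rep] at this
      simpa using this.symm
    have h0 := h 0
    have h1 := h 1
    have h2 := h 2
    have h3 := h 3
    have h4 := h 4
    simp [mat4, Fin.sum_univ_five] at h0 h1 h2 h3 h4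
    intro i
    fin_cases i <;> simp <;> omega
  · let a : Fin 5 → ℤ := fun i => z.coeff (rep4 i)
    refine ⟨![a 0 - 6 * (a 2 - a 3), a 1, a 2 - a 3, a 3, a 4], ?_⟩
    ext g
    rw [key, coeff_central4 z hz g]
    change a (cls4 g) = _
    generalize cls4 g = i
    fin_cases i <;> simp [mat4, Fin.sum_univ_five] <;> ring
end
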